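/- Let R be a ring and F a class of left R-modules such that every module in F is a quotient of a projective, every module has F-dimension ≤ n (global F-dimension ≤ n), and let Y be a module with Ext^i_R(F, Y) = 0 for all 1 ≤ i ≤ n+1 and all F ∈ F. Then Y has injective dimension ≤ n. -/

import Mathlib

open CategoryTheory

universe u

noncomputable section

variable {R : Type u} [Ring R]

/-- Membership in `F ∪ {0}`. -/
def MemF0 (F : ModuleCat.{u} R → Prop) (M : ModuleCat.{u} R) : Prop :=
  F M ∨ Subsingleton M

/-- There is a short exact sequence `0 → A → B → C → 0`. -/
def IsSES {R : Type u} [Ring R] (A B C : ModuleCat.{u} R) : Prop :=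
  ∃ (f : A ⟶ B) (g : B ⟶ C),
    Function.Injective f ∧ Function.Surjective g ∧ Function.Exact f g

/-- `FDimLE F n M` : `M` has left `F`-dimension `≤ n`, i.e. there is an exact sequence
`0 → F_n → ⋯ → F_0 → M → 0` with all `F_j ∈ F ∪ {0}`. -/
def FDimLE (F : ModuleCat.{u} R → Prop) : ℕ → ModuleCat.{u} R → Prop
  | 0, M => MemF0 F M
  | n + 1, M => ∃ K F0 : ModuleCat.{u} R, MemF0 F F0 ∧ IsSES K F0 M ∧ FDimLE F n K

/-- `M` admits a (possibly infinite) `F`-resolution `⋯ → F_1 → F_0 → M → 0`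
with all terms in `F ∪ {0}`. -/
def HasFRes (F : ModuleCat.{u} R → Prop) (M : ModuleCat.{u} R) : Prop :=
  ∃ K Fo : ℕ → ModuleCat.{u} R, K 0 = M ∧
    ∀ n, MemF0 F (Fo n) ∧ IsSES (K (n + 1)) (Fo n) (K n)

/-- `IsFKernel F n K X` : there is an exact sequence
`0 → K → F_n → ⋯ → F_0 → X → 0` with all `F_i ∈ F`. -/
def IsFKernel (F : ModuleCat.{u} R → Prop) : ℕ → ModuleCat.{u} R → ModuleCat.{u} R → Prop
  | 0, K, X => ∃ F0, F F0 ∧ IsSES K F0 X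
  | n + 1, K, X => ∃ K1 F0, F F0 ∧ IsSES K1 F0 X ∧ IsFKernel F n K K1

/-- The class `F` defines a homological dimension. -/
def DefinesHomDim (F : ModuleCat.{u} R → Prop) : Prop :=
  (∀ K Fm M : ModuleCat.{u} R, F Fm → IsSES K Fm M → HasFRes F M → HasFRes F K) ∧
  (∀ (n : ℕ) (K X : ModuleCat.{u} R), FDimLE F (n + 1) X → IsFKernel F n K X → F K)

/-- `M` is a homomorphic image of a module in `F`. -/
def IsImageOfF (F : ModuleCat.{u} R → Prop) (M : ModuleCat.{u} R) : Prop :=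
  ∃ F0 : ModuleCat.{u} R, F F0 ∧ ∃ g : F0 ⟶ M, Function.Surjective g

/-- `F` is closed under finite (binary) direct sums. -/
def ClosedUnderFinSums (F : ModuleCat.{u} R → Prop) : Prop :=
  ∀ A B : ModuleCat.{u} R, F A → F B → F (ModuleCat.of R (A × B))

/-- The class of homomorphic images of modules in `F` is closed under extensions. -/
def ImagesClosedUnderExt (F : ModuleCat.{u} R → Prop) : Prop :=
  ∀ (A B C : ModuleCat.{u} R) (f : A ⟶ B) (g : B ⟶ C),
    Function.Injective f → Function.Surjective g → Function.Exact f g →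
      IsImageOfF F A → IsImageOfF F C → IsImageOfF F B

/-- `Ext^i(M, N)` vanishes. -/
def ExtZero {R : Type u} [Ring R] (i : ℕ) (M N : ModuleCat.{u} R) : Prop :=
  Subsingleton (((Ext ℤ (ModuleCat.{u} R) i).obj (Opposite.op M)).obj N)

end

theorem extZero_iff_cocycle {R : Type u} [Ring R] {M : ModuleCat.{u} R}
    (P : ProjectiveResolution M) (Y : ModuleCat.{u} R) (k : ℕ) :
    ExtZero (k + 1) M Y ↔ ∀ f : P.complex.X (k + 1) ⟶ Y, P.complex.d (k + 2) (k + 1) ≫ f = 0 →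
      ∃ g : P.complex.X k ⟶ Y, P.complex.d (k + 1) k ≫ g = f := by
  unfold ExtZero
  rw [← ModuleCat.isZero_iff_subsingleton, (P.isoExt (R := ℤ) (k + 1) Y).isZero_iff,
    ← HomologicalComplex.exactAt_iff_isZero_homology,
    HomologicalComplex.exactAt_iff' _ k (k + 1) (k + 2) (by simp) (by simp),
    ShortComplex.moduleCat_exact_iff]
  exact Iff.rfl

theorem ext_iff_cocycle {R : Type u} [Ring R] {M : ModuleCat.{u} R}
    (P : ProjectiveResolution M) (Y : ModuleCat.{u} R) (k : ℕ) :
    Subsingleton (Abelian.Ext M Y (k + 1)) ↔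
    ∀ f : P.complex.X (k + 1) ⟶ Y, P.complex.d (k + 2) (k + 1) ≫ f = 0 →
      ∃ g : P.complex.X k ⟶ Y, P.complex.d (k + 1) k ≫ g = f := by
  constructor
  · intro h f hf
    exact (P.extMk_eq_zero_iff f (k + 2) rfl hf k rfl).1 (Subsingleton.elim _ _)
  · intro h
    refine subsingleton_of_forall_eq 0 fun a => ?_
    obtain ⟨f, hf, rfl⟩ := P.extMk_surjective a (k + 2) rfl
    exact (P.extMk_eq_zero_iff f (k + 2) rfl hf k rfl).2 (h f hf)

theorem extZero_iff {R : Type u} [Ring R] (M Y : ModuleCat.{u} R) (k : ℕ) :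
    ExtZero (k + 1) M Y ↔ Subsingleton (Abelian.Ext M Y (k + 1)) :=
  (extZero_iff_cocycle (projectiveResolution M) Y k).trans
    (ext_iff_cocycle (projectiveResolution M) Y k).symm

theorem ext_of_ses {R : Type u} [Ring R] {A B M : ModuleCat.{u} R} (Y : ModuleCat.{u} R)
    (h : IsSES A B M) (k : ℕ) (hA : Subsingleton (Abelian.Ext A Y k))
    (hB : Subsingleton (Abelian.Ext B Y (k + 1))) :
    Subsingleton (Abelian.Ext M Y (k + 1)) := by
  obtain ⟨f, g, hf, hg, he⟩ := h
  have w : f ≫ g = 0 := by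
    ext x
    exact he.apply_apply_eq_zero x
  let S := ShortComplex.mk f g w
  have hS : S.ShortExact :=
    { exact := (ShortComplex.ShortExact.moduleCat_exact_iff_function_exact S).2 he
      mono_f := (ModuleCat.mono_iff_injective f).2 hf
      epi_g := (ModuleCat.epi_iff_surjective g).2 hg }
  refine subsingleton_of_forall_eq 0 fun x => ?_
  obtain ⟨y, hy⟩ := Abelian.Ext.contravariant_sequence_exact₃ hS Y x
    (hB.elim _ _) (add_comm 1 k)
  rw [← hy, show y = 0 from hA.elim _ _, Abelian.Ext.comp_zero]

theorem ext_of_memF0 {R : Type u} [Ring R] (F : ModuleCat.{u} R → Prop) (Y M : ModuleCat.{u} R)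
    (k : ℕ) (hY : ∀ Fm, F Fm → ExtZero (k + 1) Fm Y) (hM : MemF0 F M) :
    Subsingleton (Abelian.Ext M Y (k + 1)) := by
  rcases hM with hM | hM
  · exact (extZero_iff M Y k).1 (hY M hM)
  · have : Projective M := (ModuleCat.isZero_of_subsingleton M).projective
    exact Abelian.Ext.subsingleton_of_projective M Y k

theorem ext_of_fdim {R : Type u} [Ring R] (F : ModuleCat.{u} R → Prop) (Y : ModuleCat.{u} R)
    (k : ℕ) : ∀ M, (∀ i, 1 ≤ i → i ≤ k + 1 → ∀ Fm, F Fm → ExtZero i Fm Y) → FDimLE F k M →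
    Subsingleton (Abelian.Ext M Y (k + 1)) := by
  induction k with
  | zero => exact fun M hY hM => ext_of_memF0 F Y M 0 (hY 1 le_rfl le_rfl) hM
  | succ k ih =>
    rintro M hY ⟨K, F0, hF, hs, hK⟩
    exact ext_of_ses Y hs (k + 1) (ih K (fun i h1 h2 => hY i h1 (by omega)) hK)
      (ext_of_memF0 F Y F0 (k + 1) (hY (k + 2) (by omega) le_rfl) hF)


theorem stmt11 {R : Type u} [Ring R] (F : ModuleCat.{u} R → Prop) (n : ℕ)
    (hq : ∀ Fm : ModuleCat.{u} R, F Fm →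
      ∃ (P : ModuleCat.{u} R) (g : P ⟶ Fm), Module.Projective R P ∧ Function.Surjective g)
    (hglob : ∀ M : ModuleCat.{u} R, FDimLE F n M)
    (Y : ModuleCat.{u} R)
    (hY : ∀ i, 1 ≤ i → i ≤ n + 1 → ∀ Fm, F Fm → ExtZero i Fm Y) :
    ∀ M : ModuleCat.{u} R, ExtZero (n + 1) M Y := 
  fun M => (extZero_iff M Y n).2 (ext_of_fdim F Y n M hY (hglob M))
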